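/- Let G be a VZ 2-group and χ a non-linear irreducible complex character of G. Let (H, ψ) be a pair with H ≤ G, ψ ∈ Irr(H), ψ^G = χ, ℚ(ψ) = ℚ(χ), and H/ker(ψ) isomorphic to a cyclic, generalized quaternion, dihedral, or semidihedral 2-group. Then H/ker(ψ) is isomorphic to a cyclic group, to Q₈ (quaternion group of order 8), or to D₈ (dihedral group of order 8). -/

import Mathlib

open Classical in
/-- The induced character `ψ^G` of a character `ψ` of a subgroup `H ≤ G`. -/
noncomputable def inducedChar {G : Type} [Group G] [Fintype G] (H : Subgroup G)
    (ψ : ↥H → ℂ) : G → ℂ :=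
  fun g => (Nat.card ↥H : ℂ)⁻¹ *
    ∑ x : G, if h : x * g * x⁻¹ ∈ H then ψ ⟨x * g * x⁻¹, h⟩ else 0

/-- `χ` is an irreducible complex character of `G`. -/
def IsIrrChar (G : Type) [Group G] (χ : G → ℂ) : Prop :=
  ∃ V : FDRep ℂ G, CategoryTheory.Simple V ∧ FDRep.character V = χ

/-- `G` is a VZ-group: every non-linear irreducible complex character vanishes off the
center. -/
def IsVZ (G : Type) [Group G] : Prop :=
  ∀ χ : G → ℂ, IsIrrChar G χ → χ 1 ≠ 1 → ∀ g : G, g ∉ Subgroup.center G → χ g = 0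

/-- The field of character values `ℚ(χ)`. -/
noncomputable def QChar {G : Type} (χ : G → ℂ) : Subfield ℂ :=
  Subfield.closure (Set.range χ)

/-- `K` is a generalized quaternion 2-group `Q_n` of order `2^{n+1}`, `n ≥ 2`. -/
def IsGeneralizedQuaternion (K : Type*) [Group K] : Prop :=
  ∃ n : ℕ, 2 ≤ n ∧ Nonempty (K ≃* QuaternionGroup (2 ^ (n - 1)))

/-- `K` is a dihedral 2-group `D_n` of order `2^{n+1}`, `n ≥ 3`. -/
def IsDihedral2Group (K : Type*) [Group K] : Prop :=
  ∃ n : ℕ, 3 ≤ n ∧ Nonempty (K ≃* DihedralGroup (2 ^ n))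

/-- `K` is a semidihedral group `SD_n` of order `2^{n+1}`, `n ≥ 3`. -/
def IsSemidihedralGroup (K : Type*) [Group K] : Prop :=
  ∃ n : ℕ, 3 ≤ n ∧ ∃ a b : K,
    orderOf a = 2 ^ n ∧ orderOf b = 2 ∧ b * a * b⁻¹ = a ^ (2 ^ (n - 1) - 1) ∧
    Subgroup.closure {a, b} = ⊤ ∧ Nat.card K = 2 ^ (n + 1)


set_option linter.all false
lemma aux_simple {G : Type} [Group G] [Fintype G] {V : Type} [AddCommGroup V] [Module ℂ V]
    [FiniteDimensional ℂ V] (ρ : Representation ℂ G V) [ρ.IsIrreducible] :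
    CategoryTheory.Simple (FDRep.of ρ) := by
  classical
  rw [FDRep.simple_iff_char_is_norm_one]
  have hne : (Nat.card G : ℂ) ≠ 0 := by simp [Nat.card_ne_zero, Finite.of_fintype]
  haveI := invertibleOfNonzero hne
  have h := Representation.char_orthonormal ρ ρ
  rw [if_pos ⟨Representation.Equiv.refl ρ⟩, inv_mul_eq_iff_eq_mul₀ hne] at h
  simpa using! h

lemma aux_trace_compl {G : Type} [Group G] {V : Type} [AddCommGroup V] [Module ℂ V]
    [FiniteDimensional ℂ V] (ρ : Representation ℂ G V) (A B : Subrepresentation ρ)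
    (h : IsCompl A B) (c : G) :
    ρ.character c = A.toRepresentation.character c + B.toRepresentation.character c := by
  have h' : IsCompl A.toSubmodule B.toSubmodule := by
    constructor
    · rw [disjoint_iff]
      have := disjoint_iff.mp h.1
      exact congrArg Subrepresentation.toSubmodule this
    · rw [codisjoint_iff]
      have := codisjoint_iff.mp h.2
      exact congrArg Subrepresentation.toSubmodule this
  let N : Bool → Submodule ℂ V := fun b => cond b A.toSubmodule B.toSubmodule
  have hN : DirectSum.IsInternal N :=
    (DirectSum.isInternal_submodule_iff_isCompl N (i := true) (j := false) (by simp)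
      (by ext x; cases x <;> simp)).2 h'
  have hf : ∀ i, Set.MapsTo (ρ c) (N i) (N i) := by
    intro i
    cases i
    · exact B.apply_mem_toSubmodule c
    · exact A.apply_mem_toSubmodule c
  have := LinearMap.trace_eq_sum_trace_restrict hN hf
  rw [Fintype.sum_bool] at this
  exact this

lemma aux_nat {G : Type} [Group G] [Fintype G] (hVZ : IsVZ G) (x y : G)
    (hc : x * y * x⁻¹ * y⁻¹ ∉ Subgroup.center G) (n : ℕ) :
    ∀ (V : Type) [AddCommGroup V] [Module ℂ V] [FiniteDimensional ℂ V]
      (ρ : Representation ℂ G V), Module.finrank ℂ V = n →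
      ∃ m : ℕ, ρ.character (x * y * x⁻¹ * y⁻¹) = m := by
  induction n using Nat.strong_induction_on with
  | _ n ih =>
  intro V _ _ _ ρ hn
  by_cases hirr : ρ.IsIrreducible
  · by_cases h1 : n = 1
    · refine ⟨1, ?_⟩
      rw [h1] at hn
      have hcomm : ρ x * ρ y = ρ y * ρ x := by
        obtain ⟨a, ha, -⟩ := LinearMap.existsUnique_eq_smul_id_of_finrank_eq_one hn (ρ x)
        rw [ha]
        ext v; simp
      have : ρ (x * y * x⁻¹ * y⁻¹) = 1 := by
        rw [map_mul, map_mul, map_mul, hcomm, mul_assoc (ρ y), ← map_mul ρ x, mul_inv_cancel,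
          map_one, mul_one, ← map_mul, mul_inv_cancel, map_one]
      rw [Representation.character, this, LinearMap.trace_one, hn]
    · refine ⟨0, ?_⟩
      have := hVZ (FDRep.of ρ).character ⟨_, aux_simple ρ, rfl⟩ (by
        rw [FDRep.char_one]
        intro h
        apply h1
        rw [← hn]
        exact_mod_cast h) _ hc
      simpa using! this
  · by_cases h0 : Nontrivial V
    · have hnt : Nontrivial (Subrepresentation ρ) := by
        refine ⟨⊥, ⊤, fun h => ?_⟩
        have h2 : (⊥ : Submodule ℂ V) = ⊤ := congrArg Subrepresentation.toSubmodule h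
        exact bot_ne_top h2
      have : ∃ A : Subrepresentation ρ, A ≠ ⊥ ∧ A ≠ ⊤ := by
        by_contra hcon
        push Not at hcon
        exact hirr ⟨fun A => or_iff_not_imp_left.2 (hcon A)⟩
      obtain ⟨A, hA0, hA1⟩ := this
      haveI : NeZero (Nat.card G : ℂ) := ⟨by simp [Nat.card_ne_zero, Finite.of_fintype]⟩
      obtain ⟨B, hAB⟩ := exists_isCompl A
      have key : ∀ C : Subrepresentation ρ, C ≠ ⊤ → Module.finrank ℂ C.toSubmodule < n := by
        intro C hC
        rw [← hn]
        apply Submodule.finrank_lt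
        intro h
        exact hC (Subrepresentation.toSubmodule_injective h)
      have hB1 : B ≠ ⊤ := by
        rintro rfl
        exact hA0 (by simpa using hAB.1)
      obtain ⟨a, ha⟩ := ih _ (key A hA1) _ A.toRepresentation rfl
      obtain ⟨b, hb⟩ := ih _ (key B hB1) _ B.toRepresentation rfl
      refine ⟨a + b, ?_⟩
      rw [aux_trace_compl ρ A B hAB, ha, hb]
      push_cast; rfl
    · rw [not_nontrivial_iff_subsingleton] at h0
      refine ⟨0, ?_⟩
      have : ρ (x * y * x⁻¹ * y⁻¹) = 0 := by ext v; exact Subsingleton.elim _ _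
      rw [Representation.character, this]; simp

/-- right regular representation on functions -/
def auxReg (G : Type) [Group G] : Representation ℂ G (G → ℂ) where
  toFun g := LinearMap.funLeft ℂ ℂ (fun x => x * g)
  map_one' := by ext; simp [LinearMap.funLeft]
  map_mul' g h := by
    refine LinearMap.ext fun f => funext fun x => ?_
    simp [LinearMap.funLeft, mul_assoc]

lemma aux_reg_trace {G : Type} [Group G] [Fintype G] (c : G) (hc : c ≠ 1) :
    (auxReg G).character c = 0 := by
  classical
  rw [Representation.character, LinearMap.trace_eq_matrix_trace ℂ (Pi.basisFun ℂ G), Matrix.trace]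
  apply Finset.sum_eq_zero
  intro x _
  simp [LinearMap.toMatrix_apply, auxReg, LinearMap.funLeft, Pi.single_apply, hc]

lemma aux_central {G : Type} [Group G] [Fintype G] (hVZ : IsVZ G) (x y : G) :
    x * y * x⁻¹ * y⁻¹ ∈ Subgroup.center G := by
  by_contra hc
  have h1 : x * y * x⁻¹ * y⁻¹ ≠ 1 := fun h => hc (h ▸ one_mem _)
  haveI : NeZero (Nat.card G : ℂ) := ⟨by simp [Nat.card_ne_zero, Finite.of_fintype]⟩
  let A : Subrepresentation (auxReg G) := ⟨(auxReg G).invariants, fun g v hv => by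
    rw [hv g]; exact hv⟩
  obtain ⟨B, hAB⟩ := exists_isCompl A
  obtain ⟨b, hb⟩ := aux_nat hVZ x y hc _ _ B.toRepresentation rfl
  have ht := aux_trace_compl _ A B hAB (x * y * x⁻¹ * y⁻¹)
  rw [aux_reg_trace _ h1, hb] at ht
  have hA : A.toRepresentation (x * y * x⁻¹ * y⁻¹) = 1 := by
    refine LinearMap.ext fun v => Subtype.ext ?_
    exact v.2 _
  rw [Representation.character, hA, LinearMap.trace_one] at ht
  have hpos : 0 < Module.finrank ℂ A.toSubmodule := by
    rw [Module.finrank_pos_iff_exists_ne_zero]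
    refine ⟨⟨fun _ => 1, fun g => rfl⟩, fun h => ?_⟩
    have := congrFun (congrArg Subtype.val h) 1
    simp at this
  have : (Module.finrank ℂ A.toSubmodule + b : ℕ) = 0 := by exact_mod_cast ht.symm
  omega

theorem stmt13 {G : Type} [Group G] [Fintype G]
    (h2gp : ∃ k : ℕ, Fintype.card G = 2 ^ k) (hVZ : IsVZ G)
    (χ : G → ℂ) (hχ : IsIrrChar G χ) (hnl : χ 1 ≠ 1)
    (H : Subgroup G) (ψ : ↥H → ℂ) (hψ : IsIrrChar ↥H ψ)
    (hind : inducedChar H ψ = χ) (hfield : QChar ψ = QChar χ)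
    (N : Subgroup ↥H) [N.Normal] (hN : (N : Set ↥H) = {h : ↥H | ψ h = ψ 1})
    (hiso : IsCyclic (↥H ⧸ N) ∨ IsGeneralizedQuaternion (↥H ⧸ N) ∨
      IsDihedral2Group (↥H ⧸ N) ∨ IsSemidihedralGroup (↥H ⧸ N)) :
    IsCyclic (↥H ⧸ N) ∨ Nonempty ((↥H ⧸ N) ≃* QuaternionGroup 2) ∨
      Nonempty ((↥H ⧸ N) ≃* DihedralGroup 4) := by
  have hK : ∀ a b c : ↥H ⧸ N, c * (a * b * a⁻¹ * b⁻¹) = (a * b * a⁻¹ * b⁻¹) * c := by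
    intro a b c
    obtain ⟨a, rfl⟩ := QuotientGroup.mk_surjective a
    obtain ⟨b, rfl⟩ := QuotientGroup.mk_surjective b
    obtain ⟨c, rfl⟩ := QuotientGroup.mk_surjective c
    have h := Subgroup.mem_center_iff.1 (aux_central hVZ (a : G) b) c
    have h' : c * (a * b * a⁻¹ * b⁻¹) = (a * b * a⁻¹ * b⁻¹) * c := Subtype.ext (by simpa using h)
    exact congrArg (QuotientGroup.mk (s := N)) h'
  clear hN hψ hind hfield
  rcases hiso with h | ⟨n, hn, ⟨e⟩⟩ | ⟨n, hn, ⟨e⟩⟩ | ⟨n, hn, a, b, ha, hb, hab, -, -⟩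
  · exact Or.inl h
  · right; left
    have hQ : ∀ a b c : QuaternionGroup (2 ^ (n - 1)),
        c * (a * b * a⁻¹ * b⁻¹) = (a * b * a⁻¹ * b⁻¹) * c := by
      intro a b c
      have := congrArg e (hK (e.symm a) (e.symm b) (e.symm c))
      simpa using this
    have h := hQ (.a 1) (.xa 0) (.xa 0)
    have h4 : ((4 : ℕ) : ZMod (2 * 2 ^ (n - 1))) = 0 := by
      have i1 : ∀ i : ZMod (2 * 2 ^ (n - 1)),
          (QuaternionGroup.a i : QuaternionGroup (2 ^ (n - 1)))⁻¹ = .a (-i) := fun _ => rfl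
      have i2 : ∀ i : ZMod (2 * 2 ^ (n - 1)),
          (QuaternionGroup.xa i : QuaternionGroup (2 ^ (n - 1)))⁻¹ =
            .xa (((2 ^ (n - 1) : ℕ) : ZMod (2 * 2 ^ (n - 1))) + i) := fun _ => rfl
      have i3 : (2 : ZMod (2 * 2 ^ (n - 1))) * ((2 ^ (n - 1) : ℕ) : ZMod (2 * 2 ^ (n - 1))) = 0 := by
        exact_mod_cast ZMod.natCast_self (2 * 2 ^ (n - 1))
      simp only [QuaternionGroup.a_mul_xa, i1, i2,
        QuaternionGroup.xa_mul_a, QuaternionGroup.xa_mul_xa, QuaternionGroup.a_mul_a,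
        QuaternionGroup.xa.injEq] at h
      generalize ((2 ^ (n - 1) : ℕ) : ZMod (2 * 2 ^ (n - 1))) = t at h i3
      push_cast
      linear_combination h - 2 * i3
    rw [ZMod.natCast_eq_zero_iff] at h4
    have h5 := Nat.le_of_dvd (by norm_num) h4
    have hn2 : n = 2 := by
      by_contra hne
      have : 2 ^ 2 ≤ 2 ^ (n - 1) := Nat.pow_le_pow_right (by norm_num) (by omega)
      omega
    subst hn2
    exact ⟨e⟩
  · exfalso
    have hQ : ∀ a b c : DihedralGroup (2 ^ n),
        c * (a * b * a⁻¹ * b⁻¹) = (a * b * a⁻¹ * b⁻¹) * c := by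
      intro a b c
      have := congrArg e (hK (e.symm a) (e.symm b) (e.symm c))
      simpa using this
    have h := hQ (.r 1) (.sr 0) (.sr 0)
    have h4 : ((4 : ℕ) : ZMod (2 ^ n)) = 0 := by
      simp only [DihedralGroup.r_mul_sr, DihedralGroup.inv_r, DihedralGroup.inv_sr,
        DihedralGroup.sr_mul_r, DihedralGroup.sr_mul_sr, DihedralGroup.r_mul_r,
        DihedralGroup.sr.injEq] at h
      push_cast
      linear_combination h
    rw [ZMod.natCast_eq_zero_iff] at h4
    have h5 := Nat.le_of_dvd (by norm_num) h4
    have : 2 ^ 3 ≤ 2 ^ n := Nat.pow_le_pow_right (by norm_num) hn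
    omega
  · exfalso
    obtain ⟨s, hs⟩ : ∃ s, 2 ^ (n - 1) = 2 * s + 4 := by
      obtain ⟨k, rfl⟩ : ∃ k, n = k + 3 := ⟨n - 3, by omega⟩
      have : 1 ≤ 2 ^ k := Nat.one_le_two_pow
      refine ⟨2 * 2 ^ k - 2, ?_⟩
      have : 2 ^ (k + 3 - 1) = 4 * 2 ^ k := by
        rw [show k + 3 - 1 = k + 2 by omega, pow_add]; ring
      omega
    have hs2 : 2 ^ n = 4 * s + 8 := by
      obtain ⟨k, rfl⟩ : ∃ k, n = k + 1 := ⟨n - 1, by omega⟩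
      rw [Nat.add_sub_cancel] at hs
      rw [pow_succ, hs]; ring
    rw [hs, show 2 * s + 4 - 1 = 2 * s + 3 by omega] at hab
    have h := hK b a b
    rw [hab] at h
    have e1 : a ^ (2 * s + 3) * a⁻¹ = a ^ (2 * s + 2) := by
      rw [pow_succ, mul_inv_cancel_right]
    rw [e1] at h
    have h2 : b * a ^ (2 * s + 2) * b⁻¹ = a ^ (2 * s + 2) := by rw [h, mul_inv_cancel_right]
    rw [← conj_pow, hab, ← pow_mul] at h2
    rw [pow_inj_mod, ha, hs2] at h2
    have h3 : (4 * s + 8 : ℤ) ∣ (2 * s + 3) * (2 * s + 2) - (2 * s + 2) := by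
      have := (Nat.modEq_iff_dvd.1 (show (2 * s + 2) ≡ (2 * s + 3) * (2 * s + 2) [MOD (4 * s + 8)] from h2.symm))
      push_cast at this
      exact this
    have h4 : (4 * s + 8 : ℤ) ∣ 4 := by
      have : (4 : ℤ) = ((2 * s + 3) * (2 * s + 2) - (2 * s + 2)) - (4 * s + 8) * s := by ring
      have h5 := dvd_sub h3 (dvd_mul_right (4 * s + 8 : ℤ) s)
      rwa [← this] at h5
    have := Int.le_of_dvd (by norm_num) h4
    omega
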